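/- Fix s ∈ [0, 1], γ ∈ (1, 2] and N₀ ≥ 0. Let C : [s, 1] → ℝ be a bounded non-decreasing function and let f : [s, 1] × 𝕋 → [0, ∞) be a bounded jointly measurable function. Suppose that for all t ∈ [s, 1] and x ∈ 𝕋 one has f(t, x) ≤ C(t) + N₀ ∫ₛᵗ ∫_𝕋 p_{t−r}(x,y)^γ f(r,y) dy dr. Then there exists a constant N = N(γ, N₀) > 0, independent of s, C and f, such that sup_{x∈𝕋} f(t, x) ≤ N C(t) for all t ∈ [s, 1]. -/

import Mathlib

open MeasureTheory Real Set ENNReal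

noncomputable section

instance fact01 : Fact ((0:ℝ) < 1) := ⟨one_pos⟩

/-- The Gaussian heat kernel on `ℝ`: `p^ℝ_t(z) = (4πt)^(-1/2) exp(-z²/(4t))`. -/
def gaussKer (t z : ℝ) : ℝ := (4 * π * t) ^ (-(1:ℝ)/2) * Real.exp (-(z ^ 2) / (4 * t))

/-- The periodized heat kernel, as a (1-periodic) function of a real representative:
`a ↦ ∑_{k ∈ ℤ} p^ℝ_t(a + k)`. -/
def perKer (t a : ℝ) : ℝ := ∑' k : ℤ, gaussKer t (a + (k : ℝ))

/-- The heat kernel on the torus `𝕋 = ℝ/ℤ`: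
`p_t(x,y) = ∑_{k ∈ ℤ} p^ℝ_t(x - y + k)`, defined via the representative of `x - y` in `[0,1)`. -/
def heatKer (t : ℝ) (x y : UnitAddCircle) : ℝ :=
  AddCircle.liftIco 1 0 (perKer t) (x - y)

theorem gaussKer_nonneg {t : ℝ} (ht : 0 ≤ t) (z : ℝ) : 0 ≤ gaussKer t z := by
  unfold gaussKer
  positivity

theorem measurable_gaussKer (t : ℝ) : Measurable (gaussKer t) := by
  unfold gaussKer
  fun_prop

theorem lintegral_gaussKer {t : ℝ} (ht : 0 < t) : ∫⁻ z, ENNReal.ofReal (gaussKer t z) = 1 := by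
  have hrw : gaussKer t = fun z => (4 * π * t) ^ (-(1:ℝ)/2) * Real.exp (-(1 / (4 * t)) * z ^ 2) := by
    funext z
    unfold gaussKer
    congr 2
    ring
  have hint : Integrable (gaussKer t) := by
    rw [hrw]
    exact (integrable_exp_neg_mul_sq (by positivity)).const_mul _
  rw [← ofReal_integral_eq_lintegral_ofReal hint
    (Filter.Eventually.of_forall fun z => gaussKer_nonneg ht.le z), hrw, integral_const_mul,
    integral_gaussian, neg_div, Real.rpow_neg (by positivity), ← Real.sqrt_eq_rpow,
    show π / (1 / (4 * t)) = 4 * π * t by field_simp, inv_mul_cancel₀ (by positivity),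
    ENNReal.ofReal_one]

theorem perKer_eq_toReal {t : ℝ} (ht : 0 ≤ t) (a : ℝ) :
    perKer t a = (∑' k : ℤ, ENNReal.ofReal (gaussKer t (a + (k : ℝ)))).toReal := by
  rw [ENNReal.tsum_toReal_eq fun _ => ENNReal.ofReal_ne_top]
  exact tsum_congr fun k => (ENNReal.toReal_ofReal (gaussKer_nonneg ht _)).symm

theorem measurable_perKer {t : ℝ} (ht : 0 ≤ t) : Measurable (perKer t) := by
  have h : perKer t = fun a => (∑' k : ℤ, ENNReal.ofReal (gaussKer t (a + (k : ℝ)))).toReal :=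
    funext (perKer_eq_toReal ht)
  rw [h]
  exact (Measurable.tsum fun k => ((measurable_gaussKer t).comp
    (measurable_id.add_const _)).ennreal_ofReal).ennreal_toReal

theorem lintegral_perKer_le {t : ℝ} (ht : 0 < t) :
    ∫⁻ a in Ioc (0:ℝ) (0 + 1), ENNReal.ofReal (perKer t a) ≤ 1 := by
  have hshift (k : ℤ) : ∫⁻ a in Ioc (0:ℝ) (0 + 1), ENNReal.ofReal (gaussKer t (a + (k : ℝ)))
      = ∫⁻ z in Ioc (k:ℝ) (k + 1), ENNReal.ofReal (gaussKer t z) := by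
    have h := (measurePreserving_add_right volume (k:ℝ)).setLIntegral_comp_preimage_emb
      (measurableEmbedding_addRight (k:ℝ)) (fun z => ENNReal.ofReal (gaussKer t z))
      (Ioc (k:ℝ) (k + 1))
    rw [Set.preimage_add_const_Ioc, sub_self, add_sub_cancel_left] at h
    rwa [zero_add]
  calc ∫⁻ a in Ioc (0:ℝ) (0 + 1), ENNReal.ofReal (perKer t a)
      ≤ ∫⁻ a in Ioc (0:ℝ) (0 + 1), ∑' k : ℤ, ENNReal.ofReal (gaussKer t (a + (k : ℝ))) := by
        refine lintegral_mono fun a => ?_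
        rw [perKer_eq_toReal ht.le]
        exact ENNReal.ofReal_toReal_le
    _ = ∑' k : ℤ, ∫⁻ a in Ioc (0:ℝ) (0 + 1), ENNReal.ofReal (gaussKer t (a + (k : ℝ))) :=
        lintegral_tsum fun k => ((measurable_gaussKer t).comp
          (measurable_id.add_const _)).ennreal_ofReal.aemeasurable
    _ = ∑' k : ℤ, ∫⁻ z in Ioc (k:ℝ) (k + 1), ENNReal.ofReal (gaussKer t z) := tsum_congr hshift
    _ = 1 := by
        rw [← lintegral_iUnion (fun k => measurableSet_Ioc) (pairwise_disjoint_Ioc_intCast ℝ),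
          iUnion_Ioc_intCast, setLIntegral_univ, lintegral_gaussKer ht]

theorem summable_exp_neg_int_sq_div_eight :
    Summable fun k : ℤ => Real.exp (-((k:ℝ) ^ 2 / 8)) := by
  refine (summable_pow_mul_jacobiTheta₂_term_bound 0 (T := 1 / (8 * π)) (by positivity) 0).congr
    fun k => ?_
  rw [pow_zero, one_mul]
  congr 1
  field_simp
  ring

theorem gaussKer_add_int_le {t a : ℝ} (ht : 0 < t) (ht1 : t ≤ 1) (ha : a ∈ Ico (0:ℝ) 1) (k : ℤ) :
    gaussKer t (a + k) ≤ t ^ (-(1:ℝ)/2) * (Real.exp 1 * Real.exp (-((k:ℝ) ^ 2 / 8))) := by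
  unfold gaussKer
  have hπ : 1 ≤ 4 * π := by linarith [Real.pi_gt_three]
  refine mul_le_mul ?_ ?_ (by positivity) (by positivity)
  · exact Real.rpow_le_rpow_of_nonpos ht (by nlinarith) (by norm_num)
  · rw [← Real.exp_add, Real.exp_le_exp, neg_div]
    have h1 : (a + k) ^ 2 / 4 ≤ (a + k) ^ 2 / (4 * t) :=
      div_le_div_of_nonneg_left (sq_nonneg _) (by positivity) (by linarith)
    nlinarith [sq_nonneg (2 * a + k), ha.1, ha.2]

theorem perKer_le {t a : ℝ} (ht : 0 < t) (ht1 : t ≤ 1) (ha : a ∈ Ico (0:ℝ) 1) :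
    perKer t a ≤
      t ^ (-(1:ℝ)/2) * (Real.exp 1 * ∑' k : ℤ, Real.exp (-((k:ℝ) ^ 2 / 8))) := by
  rw [← tsum_mul_left, ← tsum_mul_left]
  have hs := (summable_exp_neg_int_sq_div_eight.mul_left (Real.exp 1)).mul_left (t ^ (-(1:ℝ)/2))
  exact (hs.of_nonneg_of_le (fun k => gaussKer_nonneg ht.le _)
    (gaussKer_add_int_le ht ht1 ha)).tsum_le_tsum (gaussKer_add_int_le ht ht1 ha) hs

theorem measurable_liftIco_perKer {t : ℝ} (ht : 0 ≤ t) :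
    Measurable (AddCircle.liftIco 1 0 (perKer t)) :=
  ((measurable_perKer ht).comp measurable_subtype_coe).comp
    (AddCircle.measurableEquivIco (1:ℝ) 0).measurable

theorem exists_liftIco_perKer_eq (t : ℝ) (x : UnitAddCircle) :
    ∃ a ∈ Ico (0:ℝ) 1, AddCircle.liftIco 1 0 (perKer t) x = perKer t a :=
  ⟨AddCircle.equivIco 1 0 x, by simpa using (AddCircle.equivIco 1 0 x).2, rfl⟩

theorem heatKer_nonneg {t : ℝ} (ht : 0 ≤ t) (x y : UnitAddCircle) : 0 ≤ heatKer t x y := by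
  obtain ⟨a, -, h⟩ := exists_liftIco_perKer_eq t (x - y)
  rw [heatKer, h]
  exact tsum_nonneg fun k => gaussKer_nonneg ht _

theorem lintegral_heatKer_le {t : ℝ} (ht : 0 < t) (x : UnitAddCircle) :
    ∫⁻ y, ENNReal.ofReal (heatKer t x y) ≤ 1 := by
  unfold heatKer
  rw [lintegral_sub_left_eq_self (μ := (volume : Measure UnitAddCircle))
    (fun y => ENNReal.ofReal (AddCircle.liftIco 1 0 (perKer t) y)) x,
    ← UnitAddCircle.lintegral_preimage 0]
  refine le_trans (le_of_eq ?_) (lintegral_perKer_le ht)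
  rw [← restrict_Ioo_eq_restrict_Ioc]
  refine setLIntegral_congr_fun measurableSet_Ioo fun a ha => ?_
  rw [AddCircle.liftIco_coe_apply (Ioo_subset_Ico_self ha)]

theorem integrable_heatKer {t : ℝ} (ht : 0 < t) (x : UnitAddCircle) :
    Integrable fun y => heatKer t x y := by
  have hm : Measurable fun y => heatKer t x y :=
    (measurable_liftIco_perKer ht.le).comp (measurable_const.sub measurable_id)
  refine ⟨hm.aestronglyMeasurable, ?_⟩
  rw [hasFiniteIntegral_iff_ofReal (Filter.Eventually.of_forall fun y => heatKer_nonneg ht.le x y)]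
  exact (lintegral_heatKer_le ht x).trans_lt ENNReal.one_lt_top

theorem integral_heatKer_le {t : ℝ} (ht : 0 < t) (x : UnitAddCircle) :
    ∫ y, heatKer t x y ≤ 1 := by
  rw [integral_eq_lintegral_of_nonneg_ae
    (Filter.Eventually.of_forall fun y => heatKer_nonneg ht.le x y)
    (integrable_heatKer ht x).aestronglyMeasurable]
  exact ENNReal.toReal_le_of_le_ofReal zero_le_one (by simpa using lintegral_heatKer_le ht x)

theorem rpow_le_one_add_mul_self {p γ : ℝ} (hp : 0 ≤ p) (hγ : γ ∈ Ioc (1:ℝ) 2) :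
    p ^ γ ≤ (1 + p) * p := by
  rcases le_total p 1 with h | h
  · have : p ^ γ ≤ p := Real.rpow_le_self_of_le_one hp h hγ.1.le
    nlinarith
  · have : p ^ γ ≤ p ^ (2:ℝ) := Real.rpow_le_rpow_of_exponent_le h hγ.2
    rw [Real.rpow_two] at this
    nlinarith

/-- The `γ`-th power of the heat kernel integrates any function with values in `[0, B]` to at most
a constant times `t ^ (-1/2) * B`. -/
theorem exists_integral_heatKer_rpow_mul_le :
    ∃ K : ℝ, 0 < K ∧ ∀ γ ∈ Ioc (1:ℝ) 2, ∀ t ∈ Ioc (0:ℝ) 1, ∀ (x : UnitAddCircle)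
      (g : UnitAddCircle → ℝ) (B : ℝ), (∀ y, 0 ≤ g y) → (∀ y, g y ≤ B) →
        ∫ y, heatKer t x y ^ γ * g y ≤ K * t ^ (-(1:ℝ)/2) * B := by
  set L : ℝ := Real.exp 1 * ∑' k : ℤ, Real.exp (-((k:ℝ) ^ 2 / 8))
  have hL0 : 0 ≤ L := mul_nonneg (Real.exp_pos _).le (tsum_nonneg fun k => (Real.exp_pos _).le)
  refine ⟨1 + L, by positivity, fun γ hγ t ⟨ht, ht1⟩ x g B hg hgB => ?_⟩
  have hB : 0 ≤ B := (hg 0).trans (hgB 0)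
  have hpow : 1 ≤ t ^ (-(1:ℝ)/2) := Real.one_le_rpow_of_pos_of_le_one_of_nonpos ht ht1 (by norm_num)
  have hle (y : UnitAddCircle) :
      heatKer t x y ^ γ * g y ≤ ((1 + L) * t ^ (-(1:ℝ)/2) * B) * heatKer t x y := by
    have h0 := heatKer_nonneg ht.le x y
    have h1 : 1 + heatKer t x y ≤ (1 + L) * t ^ (-(1:ℝ)/2) := by
      obtain ⟨a, ha, h⟩ := exists_liftIco_perKer_eq t (x - y)
      have := perKer_le ht ht1 ha
      rw [heatKer, h]
      linarith
    calc heatKer t x y ^ γ * g y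
        ≤ ((1 + L) * t ^ (-(1:ℝ)/2) * heatKer t x y) * B := by
          refine mul_le_mul ((rpow_le_one_add_mul_self h0 hγ).trans ?_) (hgB y) (hg y)
            (by positivity)
          exact mul_le_mul_of_nonneg_right h1 h0
      _ = _ := by ring
  calc ∫ y, heatKer t x y ^ γ * g y
      ≤ ∫ y, ((1 + L) * t ^ (-(1:ℝ)/2) * B) * heatKer t x y :=
        integral_mono_of_nonneg (Filter.Eventually.of_forall fun y =>
          mul_nonneg (Real.rpow_nonneg (heatKer_nonneg ht.le x y) _) (hg y))
          ((integrable_heatKer ht x).const_mul _) (Filter.Eventually.of_forall hle)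
    _ ≤ (1 + L) * t ^ (-(1:ℝ)/2) * B := by
        rw [integral_const_mul]
        exact mul_le_of_le_one_right (by positivity) (integral_heatKer_le ht x)

theorem integrableOn_rpow_mul_exp_neg_mul {l : ℝ} (hl : 0 < l) :
    IntegrableOn (fun u : ℝ => u ^ (-(1:ℝ)/2) * Real.exp (-(l * u))) (Ioi 0) := by
  refine (integrableOn_rpow_mul_exp_neg_mul_rpow (s := -(1:ℝ)/2) (by norm_num) one_pos hl).congr_fun
    (fun u _ => ?_) measurableSet_Ioi
  simp

theorem integrableOn_sub_rpow_mul_exp {l : ℝ} (hl : 0 < l) (s t : ℝ) :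
    IntegrableOn (fun r : ℝ => (t - r) ^ (-(1:ℝ)/2) * Real.exp (-(l * (t - r)))) (Ioo s t) := by
  have h := ((Measure.measurePreserving_sub_left volume t).integrableOn_comp_preimage
    (measurableEmbedding_subLeft t)).2 (integrableOn_rpow_mul_exp_neg_mul hl)
  rw [Set.preimage_const_sub_Ioi, sub_zero] at h
  exact h.mono_set Ioo_subset_Iio_self

theorem setIntegral_sub_rpow_mul_exp_le {l : ℝ} (hl : 0 < l) (s t : ℝ) :
    ∫ r in Ioo s t, (t - r) ^ (-(1:ℝ)/2) * Real.exp (-(l * (t - r))) ≤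
      (1 / l) ^ ((1:ℝ)/2) * Real.Gamma (1/2) := by
  have h := ((Measure.measurePreserving_sub_left volume t).integrableOn_comp_preimage
    (measurableEmbedding_subLeft t)).2 (integrableOn_rpow_mul_exp_neg_mul hl)
  have hI := (Measure.measurePreserving_sub_left volume t).setIntegral_preimage_emb
    (measurableEmbedding_subLeft t)
    (fun u : ℝ => u ^ (-(1:ℝ)/2) * Real.exp (-(l * u))) (Ioi 0)
  rw [Set.preimage_const_sub_Ioi, sub_zero] at h hI
  rw [← Real.integral_rpow_mul_exp_neg_mul_Ioi one_half_pos hl,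
    show (1:ℝ)/2 - 1 = -(1:ℝ)/2 by norm_num, ← hI]
  refine setIntegral_mono_set h ?_ Ioo_subset_Iio_self.eventuallyLE
  filter_upwards [ae_restrict_mem measurableSet_Iio] with r hr
  have : 0 < t - r := sub_pos.2 hr
  simp only [Pi.zero_apply]
  positivity

/-- A Grönwall-type inequality. Fix `γ ∈ (1,2]` and `N₀ ≥ 0`.
There is a constant `N = N(γ, N₀) > 0`, independent of `s`, `C` and `f`, such that:
whenever `s ∈ [0,1]`, `C : [s,1] → ℝ` is bounded and non-decreasing, and
`f : [s,1] × 𝕋 → [0,∞)` is bounded and jointly measurable with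
`f(t,x) ≤ C(t) + N₀ ∫ₛᵗ ∫_𝕋 p_{t−r}(x,y)^γ f(r,y) dy dr` for all `t ∈ [s,1]`, `x ∈ 𝕋`,
then `sup_x f(t,x) ≤ N C(t)` for all `t ∈ [s,1]`. -/
theorem stmt8 (γ N₀ : ℝ) (hγ : γ ∈ Set.Ioc (1:ℝ) 2) (hN₀ : 0 ≤ N₀) :
    ∃ N : ℝ, 0 < N ∧
      ∀ (s : ℝ), 0 ≤ s → s ≤ 1 → ∀ (C : ℝ → ℝ) (f : ℝ → UnitAddCircle → ℝ),
        (∀ t₁ t₂, s ≤ t₁ → t₁ ≤ t₂ → t₂ ≤ 1 → C t₁ ≤ C t₂) →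
        (∃ M : ℝ, ∀ t ∈ Set.Icc s 1, |C t| ≤ M) →
        Measurable (Function.uncurry f) →
        (∀ t ∈ Set.Icc s 1, ∀ x, 0 ≤ f t x) →
        (∃ M : ℝ, ∀ t ∈ Set.Icc s 1, ∀ x, f t x ≤ M) →
        (∀ t ∈ Set.Icc s 1, ∀ x,
          f t x ≤ C t + N₀ * ∫ r in Set.Ioc s t, ∫ y, heatKer (t - r) x y ^ γ * f r y) →
        ∀ t ∈ Set.Icc s 1, ∀ x, f t x ≤ N * C t := by
  obtain ⟨K, hK, hker⟩ := exists_integral_heatKer_rpow_mul_le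
  have hΓ : 0 < Real.Gamma (1/2) := Real.Gamma_pos_of_pos one_half_pos
  set q : ℝ := 2 * (N₀ * K * Real.Gamma (1/2)) + 1 with hq
  have hq0 : 0 < q := by positivity
  have hl : 0 < q ^ 2 := by positivity
  have hsmall : N₀ * (K * ((1 / q ^ 2) ^ ((1:ℝ)/2) * Real.Gamma (1/2))) ≤ 1 / 2 := by
    rw [← Real.sqrt_eq_rpow, Real.sqrt_div zero_le_one, Real.sqrt_one, Real.sqrt_sq hq0.le]
    have h : N₀ * (K * (1 / q * Real.Gamma (1/2))) = N₀ * K * Real.Gamma (1/2) / q := by ring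
    rw [h, div_le_iff₀ hq0]
    linarith
  refine ⟨2 * Real.exp (q ^ 2), by positivity, ?_⟩
  rintro s hs0 - C f hC - - hf0 ⟨M, hM⟩ hf t ht x
  have hC0 : 0 ≤ C t := by
    have hss : s ∈ Icc s 1 := ⟨le_rfl, ht.1.trans ht.2⟩
    have h := hf s hss 0
    rw [Ioc_self, setIntegral_empty, mul_zero, add_zero] at h
    exact ((hf0 s hss 0).trans h).trans (hC s t le_rfl ht.1 ht.2)
  have hM0 : 0 ≤ M := (hf0 t ht x).trans (hM t ht x)
  have hstep (A : ℝ) (hA : 0 ≤ A)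
      (h : ∀ r ∈ Icc s t, ∀ y, f r y ≤ A * Real.exp (q ^ 2 * r)) :
      ∀ r ∈ Icc s t, ∀ y, f r y ≤ (C t + A / 2) * Real.exp (q ^ 2 * r) := by
    intro r hr y
    have hr1 : r ≤ 1 := hr.2.trans ht.2
    have hmono (v : ℝ) (hv : v ∈ Ioo s r) : ∫ z, heatKer (r - v) y z ^ γ * f v z ≤
        (K * A * Real.exp (q ^ 2 * r)) *
          ((r - v) ^ (-(1:ℝ)/2) * Real.exp (-(q ^ 2 * (r - v)))) := by
      have hv' : v ∈ Icc s t := ⟨hv.1.le, hv.2.le.trans hr.2⟩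
      refine (hker γ hγ (r - v) ⟨sub_pos.2 hv.2, by linarith [hv.1]⟩ y (f v) _
        (fun z => hf0 v ⟨hv'.1, hv'.2.trans ht.2⟩ z) (h v hv')).trans_eq ?_
      rw [show q ^ 2 * v = q ^ 2 * r + -(q ^ 2 * (r - v)) by ring, Real.exp_add]
      ring
    have hint : ∫ v in Ioc s r, ∫ z, heatKer (r - v) y z ^ γ * f v z ≤
        (K * A * Real.exp (q ^ 2 * r)) * ((1 / q ^ 2) ^ ((1:ℝ)/2) * Real.Gamma (1/2)) := by
      rw [integral_Ioc_eq_integral_Ioo]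
      refine (integral_mono_of_nonneg ?_
        ((integrableOn_sub_rpow_mul_exp hl s r).const_mul (K * A * Real.exp (q ^ 2 * r)))
        ?_).trans ?_
      · filter_upwards [ae_restrict_mem measurableSet_Ioo] with v hv
        exact integral_nonneg fun z => mul_nonneg
          (Real.rpow_nonneg (heatKer_nonneg (sub_pos.2 hv.2).le y z) _)
          (hf0 v ⟨hv.1.le, hv.2.le.trans hr1⟩ z)
      · filter_upwards [ae_restrict_mem measurableSet_Ioo] with v hv using hmono v hv
      · rw [integral_const_mul]
        exact mul_le_mul_of_nonneg_left (setIntegral_sub_rpow_mul_exp_le hl s r) (by positivity)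
    have hexp : 1 ≤ Real.exp (q ^ 2 * r) :=
      Real.one_le_exp (mul_nonneg hl.le (hs0.trans hr.1))
    calc f r y ≤ C r + N₀ * ∫ v in Ioc s r, ∫ z, heatKer (r - v) y z ^ γ * f v z :=
          hf r ⟨hr.1, hr1⟩ y
      _ ≤ C t + N₀ * ((K * A * Real.exp (q ^ 2 * r)) *
            ((1 / q ^ 2) ^ ((1:ℝ)/2) * Real.Gamma (1/2))) :=
          add_le_add (hC r t hr.1 hr.2 ht.2) (mul_le_mul_of_nonneg_left hint hN₀)
      _ = C t + N₀ * (K * ((1 / q ^ 2) ^ ((1:ℝ)/2) * Real.Gamma (1/2))) *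
            (A * Real.exp (q ^ 2 * r)) := by ring
      _ ≤ C t * Real.exp (q ^ 2 * r) + 1 / 2 * (A * Real.exp (q ^ 2 * r)) :=
          add_le_add (le_mul_of_one_le_right hC0 hexp)
            (mul_le_mul_of_nonneg_right hsmall (by positivity))
      _ = (C t + A / 2) * Real.exp (q ^ 2 * r) := by ring
  have hiter (n : ℕ) : ∀ r ∈ Icc s t, ∀ y,
      f r y ≤ (2 * C t + M * (1 / 2) ^ n) * Real.exp (q ^ 2 * r) := by
    induction n with
    | zero =>
      intro r hr y
      have hexp : 1 ≤ Real.exp (q ^ 2 * r) :=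
        Real.one_le_exp (mul_nonneg hl.le (hs0.trans hr.1))
      refine (hM r ⟨hr.1, hr.2.trans ht.2⟩ y).trans ?_
      rw [pow_zero, mul_one]
      nlinarith
    | succ n ih =>
      intro r hr y
      refine (hstep _ (by positivity) ih r hr y).trans_eq ?_
      ring
  have hlim : Filter.Tendsto
      (fun n : ℕ => (2 * C t + M * (1 / 2 : ℝ) ^ n) * Real.exp (q ^ 2 * t)) Filter.atTop
      (nhds ((2 * C t + M * 0) * Real.exp (q ^ 2 * t))) :=
    (((_root_.tendsto_pow_atTop_nhds_zero_of_lt_one (by norm_num) (by norm_num)).const_mul M).const_add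
      (2 * C t)).mul_const _
  calc f t x ≤ (2 * C t + M * 0) * Real.exp (q ^ 2 * t) :=
        ge_of_tendsto' hlim fun n => hiter n t ⟨ht.1, le_rfl⟩ x
    _ ≤ (2 * C t + M * 0) * Real.exp (q ^ 2) := by
        refine mul_le_mul_of_nonneg_left (Real.exp_le_exp.2 ?_) (by linarith)
        exact mul_le_of_le_one_right hl.le ht.2
    _ = 2 * Real.exp (q ^ 2) * C t := by ring
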